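/- arXiv:2407.15891 — 2 statements merged into one kernel-verified Lean document; each statement's English description precedes it below -/
import Mathlib

section
/- Let d be a positive integer, let W_Q and W_K be real d×d matrices, let γ, b ∈ ℝ^d, let l > 0 be a real number (the head-specific ALiBi slope), and let ε ∈ (0,1). Let x_0, x_1, …, x_m be vectors in ℝ^d satisfying ‖x_j‖² ≤ 2‖γ‖² + 2‖b‖² for every j (the LayerNorm output bound), and set q_j = W_Q x_j and k_j = W_K x_j. Define the ALiBi attention score S(m,n) = ⟨q_m, k_n⟩ − l·(m − n) for 0 ≤ n ≤ m, and the attention weight Attn(m,n) = exp(S(m,n)) / Σ_{j=0}^{m} exp(S(m,j)). Assume moreover ⟨q_m, k_m⟩ ≥ 0. Then for every n ≤ m with m − n > L, where L = (2‖W_Q^⊤ W_K‖·(‖γ‖² + ‖b‖²) − log ε)/l and ‖·‖ denotes the ℓ²-operator norm of the matrix, one has Attn(m,n) ≤ ε. -/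
open scoped BigOperators RealInnerProductSpace
open Matrix

/-- The pairing of a query `A x` with a key `B y` is the bilinear form of `Aᵀ * B`. -/
lemma inner_toEuclideanCLM_toEuclideanCLM {ι : Type*} [Fintype ι] [DecidableEq ι]
    (A B : Matrix ι ι ℝ) (x y : EuclideanSpace ℝ ι) :
    ⟪toEuclideanCLM (𝕜 := ℝ) A x, toEuclideanCLM (𝕜 := ℝ) B y⟫ =
      ⟪x, toEuclideanCLM (𝕜 := ℝ) (Aᵀ * B) y⟫ := by
  rw [inner_toEuclideanCLM, inner_toEuclideanCLM, ofLp_toEuclideanCLM, ← mulVec_mulVec,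
    dotProduct_mulVec x.ofLp, vecMul_transpose]

/-- A bounded bilinear form on vectors of squared norm at most `R` is at most `‖T‖ * R`. -/
lemma inner_apply_le_opNorm_mul {E : Type*} [NormedAddCommGroup E] [InnerProductSpace ℝ E]
    (T : E →L[ℝ] E) {x y : E} {R : ℝ} (hx : ‖x‖ ^ 2 ≤ R) (hy : ‖y‖ ^ 2 ≤ R) :
    ⟪x, T y⟫ ≤ ‖T‖ * R := by
  calc ⟪x, T y⟫ ≤ ‖x‖ * ‖T y‖ := real_inner_le_norm _ _
    _ ≤ ‖x‖ * (‖T‖ * ‖y‖) := by gcongr; exact T.le_opNorm y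
    _ = ‖T‖ * (‖x‖ * ‖y‖) := by ring
    _ ≤ ‖T‖ * R := by
      gcongr
      nlinarith [sq_nonneg (‖x‖ - ‖y‖)]

/-- A softmax weight is at most `exp (S i)` as soon as some score is nonnegative. -/
lemma exp_div_sum_exp_le {ι : Type*} [Fintype ι] (S : ι → ℝ) (i : ι) {j : ι} (hj : 0 ≤ S j) :
    Real.exp (S i) / ∑ k, Real.exp (S k) ≤ Real.exp (S i) := by
  refine div_le_self (Real.exp_pos _).le ((Real.one_le_exp hj).trans ?_)
  exact Finset.single_le_sum (f := fun k => Real.exp (S k))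
    (fun k _ => (Real.exp_pos _).le) (Finset.mem_univ j)

/-- Theorem 1 (RazorAttention, attention decay for ALiBi heads).
Inputs `x 0, …, x m` satisfy the LayerNorm output bound
`‖x j‖² ≤ 2‖γ‖² + 2‖b‖²`; queries and keys are `q j = W_Q (x j)`,
`k j = W_K (x j)`; ALiBi scores are `S n = ⟨q m, k n⟩ - l (m - n)`, and the
attention weight is the softmax `Attn n = exp (S n) / Σ_j exp (S j)`.
Assuming `⟨q m, k m⟩ ≥ 0`, for every position `n` with
`m - n > L`, where `L = (2 ‖W_Qᵀ W_K‖ (‖γ‖² + ‖b‖²) - log ε) / l` and `‖·‖`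
is the ℓ²-operator norm, one has `Attn n ≤ ε`. -/
theorem alibi_attention_decay (d : ℕ) (hd : 0 < d)
    (WQ WK : Matrix (Fin d) (Fin d) ℝ) (γ b : EuclideanSpace ℝ (Fin d))
    (l : ℝ) (hl : 0 < l) (ε : ℝ) (hε : ε ∈ Set.Ioo (0 : ℝ) 1)
    (m : ℕ) (x : Fin (m + 1) → EuclideanSpace ℝ (Fin d))
    (hx : ∀ j : Fin (m + 1), ‖x j‖ ^ 2 ≤ 2 * ‖γ‖ ^ 2 + 2 * ‖b‖ ^ 2)
    (q k : Fin (m + 1) → EuclideanSpace ℝ (Fin d))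
    (hq : ∀ j : Fin (m + 1), q j = Matrix.toEuclideanCLM (𝕜 := ℝ) WQ (x j))
    (hk : ∀ j : Fin (m + 1), k j = Matrix.toEuclideanCLM (𝕜 := ℝ) WK (x j))
    (S : Fin (m + 1) → ℝ)
    (hS : ∀ n : Fin (m + 1), S n = ⟪q (Fin.last m), k n⟫ - l * ((m : ℝ) - (n : ℕ)))
    (Attn : Fin (m + 1) → ℝ)
    (hAttn : ∀ n : Fin (m + 1),
      Attn n = Real.exp (S n) / ∑ j : Fin (m + 1), Real.exp (S j))
    (hqk : 0 ≤ ⟪q (Fin.last m), k (Fin.last m)⟫)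
    (L : ℝ)
    (hL : L = (2 * ‖Matrix.toEuclideanCLM (𝕜 := ℝ) (WQᵀ * WK)‖ *
      (‖γ‖ ^ 2 + ‖b‖ ^ 2) - Real.log ε) / l) :
    ∀ n : Fin (m + 1), (m : ℝ) - (n : ℕ) > L → Attn n ≤ ε := by
  intro n hn
  have hlast : 0 ≤ S (Fin.last m) := by
    rw [hS, Fin.val_last]
    simpa using hqk
  have hinner : ⟪q (Fin.last m), k n⟫ ≤
      ‖toEuclideanCLM (𝕜 := ℝ) (WQᵀ * WK)‖ * (2 * ‖γ‖ ^ 2 + 2 * ‖b‖ ^ 2) := by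
    rw [hq, hk, inner_toEuclideanCLM_toEuclideanCLM]
    exact inner_apply_le_opNorm_mul _ (hx _) (hx n)
  rw [gt_iff_lt, hL, div_lt_iff₀ hl] at hn
  have hScore : S n ≤ Real.log ε := by
    rw [hS]
    linarith
  calc Attn n ≤ Real.exp (S n) := hAttn n ▸ exp_div_sum_exp_le S n hlast
    _ ≤ ε := (Real.le_log_iff_exp_le hε.1).1 hScore
end

section
/- Let m be a natural number, let l > 0 and B be real numbers, let ε ∈ (0,1), and let s : {0,…,m} → ℝ be scores of the form s(j) = a_j − l·(m − j) where a_j ∈ ℝ satisfies a_j ≤ B for all j and a_m ≥ 0. Then for every n ≤ m with m − n ≥ (B − log ε)/l, the softmax weight exp(s(n)) / Σ_{j=0}^{m} exp(s(j)) is at most ε. -/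
open scoped BigOperators

/-- Abstract ALiBi decay estimate: if scores have the form
`s j = a j - l * (m - j)` with content terms `a j ≤ B` and `a m ≥ 0`, then the
softmax weight at any position `n` with `m - n ≥ (B - log ε) / l` is at most `ε`. -/
theorem softmax_alibi_decay (m : ℕ) (l B : ℝ) (hl : 0 < l)
    (ε : ℝ) (hε : ε ∈ Set.Ioo (0 : ℝ) 1)
    (a : Fin (m + 1) → ℝ) (haB : ∀ j, a j ≤ B) (ham : 0 ≤ a (Fin.last m))
    (s : Fin (m + 1) → ℝ)
    (hs : ∀ j : Fin (m + 1), s j = a j - l * ((m : ℝ) - (j : ℕ))) :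
    ∀ n : Fin (m + 1), (B - Real.log ε) / l ≤ (m : ℝ) - (n : ℕ) →
      Real.exp (s n) / ∑ j : Fin (m + 1), Real.exp (s j) ≤ ε := by
  intro n hn
  have h_num : Real.exp (s n) ≤ ε := by
    rw [← Real.le_log_iff_exp_le hε.1, hs n]
    rw [div_le_iff₀ hl] at hn
    linarith [haB n]
  have h_last : 1 ≤ Real.exp (s (Fin.last m)) := by
    rw [Real.one_le_exp_iff, hs]
    simpa using ham
  have h_sum : 1 ≤ ∑ j : Fin (m + 1), Real.exp (s j) :=
    h_last.trans (Finset.single_le_sum (f := fun j => Real.exp (s j))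
      (fun j _ => (Real.exp_pos _).le) (Finset.mem_univ _))
  exact (div_le_self (Real.exp_pos _).le h_sum).trans h_num
end
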